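/- Along the iteration q^{[t+1]}(x,y) = exp(−ω_{q^{[t]}}^{(μ,λ)}(x,y)) q^{[t]}(x,y) / Λ_{q^{[t]}}^{(μ,λ)} started from a joint distribution q^{[1]} with all components positive, the sequence of values −log Λ_{q^{[t]}}^{(μ,λ)} converges as t → ∞ to Ω^{(μ,λ)}(P). -/

import Mathlib

open Real Filter

noncomputable section

def IsDist {X : Type*} [Fintype X] (P : X → ℝ) : Prop :=
  (∀ x, 0 ≤ P x) ∧ ∑ x, P x = 1

def IsJoint {X Y : Type*} [Fintype X] [Fintype Y] (q : X → Y → ℝ) : Prop :=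
  (∀ x y, 0 ≤ q x y) ∧ ∑ x, ∑ y, q x y = 1

def IsCond {X Y : Type*} [Fintype X] [Fintype Y] (V : X → Y → ℝ) : Prop :=
  (∀ x y, 0 ≤ V x y) ∧ ∀ x, ∑ y, V x y = 1

def margX {X Y : Type*} [Fintype Y] (q : X → Y → ℝ) (x : X) : ℝ := ∑ y, q x y

def margY {X Y : Type*} [Fintype X] (q : X → Y → ℝ) (y : Y) : ℝ := ∑ x, q x y

/-- conditional distribution of `X` given `Y` : `q_{X|Y}(x|y)` -/
def condXY {X Y : Type*} [Fintype X] (q : X → Y → ℝ) (x : X) (y : Y) : ℝ :=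
  q x y / margY q y

/-- conditional distribution of `Y` given `X` : `q_{Y|X}(y|x)` -/
def condYX {X Y : Type*} [Fintype Y] (q : X → Y → ℝ) (x : X) (y : Y) : ℝ :=
  q x y / margX q x

/-- mutual information `I(q_X, q_{Y|X})` of a joint distribution `q` -/
def mutInfo {X Y : Type*} [Fintype X] [Fintype Y] (q : X → Y → ℝ) : ℝ :=
  ∑ x, ∑ y, q x y * Real.log (q x y / (margX q x * margY q y))

/-- divergence `D(q_X ‖ P)` -/
def klX {X Y : Type*} [Fintype X] [Fintype Y] (q : X → Y → ℝ) (P : X → ℝ) : ℝ :=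
  ∑ x, margX q x * Real.log (margX q x / P x)

/-- divergence `D(p ‖ q)` of distributions on `X` -/
def klD {X : Type*} [Fintype X] (p q : X → ℝ) : ℝ :=
  ∑ x, p x * Real.log (p x / q x)

/-- divergence `D(q ‖ p)` of joint distributions -/
def klJoint {X Y : Type*} [Fintype X] [Fintype Y] (q p : X → Y → ℝ) : ℝ :=
  ∑ x, ∑ y, q x y * Real.log (q x y / p x y)

/-- expected distortion `E_q[d(X,Y)]` -/
def Ed {X Y : Type*} [Fintype X] [Fintype Y] (q d : X → Y → ℝ) : ℝ :=
  ∑ x, ∑ y, q x y * d x y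

/-- `G(R,Δ|P)` -/
def G {X Y : Type*} [Fintype X] [Fintype Y] (P : X → ℝ) (d : X → Y → ℝ) (R Δ : ℝ) : ℝ :=
  sInf {v : ℝ | ∃ q : X → Y → ℝ, IsJoint q ∧ Ed q d ≤ Δ ∧
    v = max 0 (mutInfo q - R) + klX q P}

/-- `G^{(λ)}(R,Δ|P)` -/
def Glam {X Y : Type*} [Fintype X] [Fintype Y] (P : X → ℝ) (d : X → Y → ℝ)
    (lam R Δ : ℝ) : ℝ :=
  sInf {v : ℝ | ∃ q : X → Y → ℝ, IsJoint q ∧ Ed q d ≤ Δ ∧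
    v = lam * (mutInfo q - R) + klX q P}

/-- rate distortion function `R(Δ|P)` -/
def RD {X Y : Type*} [Fintype X] [Fintype Y] (P : X → ℝ) (d : X → Y → ℝ) (Δ : ℝ) : ℝ :=
  sInf {v : ℝ | ∃ V : X → Y → ℝ, IsCond V ∧ Ed (fun x y => P x * V x y) d ≤ Δ ∧
    v = mutInfo (fun x y => P x * V x y)}

/-- `Ω^{(μ,λ)}(P)` -/
def OmegaF {X Y : Type*} [Fintype X] [Fintype Y] (P : X → ℝ) (d : X → Y → ℝ)
    (μ lam : ℝ) : ℝ :=
  sInf {v : ℝ | ∃ q : X → Y → ℝ, IsJoint q ∧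
    v = lam * mutInfo q + klX q P + μ * Ed q d}

/-- `G^{(μ,λ)}(R,Δ|P) = Ω^{(μ,λ)}(P) − λR − μΔ` -/
def Gmulam {X Y : Type*} [Fintype X] [Fintype Y] (P : X → ℝ) (d : X → Y → ℝ)
    (μ lam R Δ : ℝ) : ℝ :=
  OmegaF P d μ lam - lam * R - μ * Δ

/-- `ω_q^{(μ,λ)}(x,y)` -/
def omg {X Y : Type*} [Fintype X] [Fintype Y] (P : X → ℝ) (d : X → Y → ℝ)
    (μ lam : ℝ) (q : X → Y → ℝ) (x : X) (y : Y) : ℝ :=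
  Real.log (margX q x ^ (1 - lam) * condXY q x y ^ lam * Real.exp (μ * d x y) / P x)

/-- `F^{(μ,λ)}(p,q) = E_q[ω_p^{(μ,λ)}(X,Y)] + D(q‖p)` -/
def Ffun {X Y : Type*} [Fintype X] [Fintype Y] (P : X → ℝ) (d : X → Y → ℝ)
    (μ lam : ℝ) (p q : X → Y → ℝ) : ℝ :=
  (∑ x, ∑ y, q x y * omg P d μ lam p x y) + klJoint q p

/-- `Λ_p^{(μ,λ)} = E_p[exp(−ω_p^{(μ,λ)}(X,Y))]` -/
def Lam {X Y : Type*} [Fintype X] [Fintype Y] (P : X → ℝ) (d : X → Y → ℝ)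
    (μ lam : ℝ) (p : X → Y → ℝ) : ℝ :=
  ∑ x, ∑ y, p x y * Real.exp (-(omg P d μ lam p x y))

/-- cutoff rate `R_cut^{(λ)}(Δ|P)` -/
def Rcut {X Y : Type*} [Fintype X] [Fintype Y] (P : X → ℝ) (d : X → Y → ℝ)
    (lam Δ : ℝ) : ℝ :=
  sInf {v : ℝ | ∃ q : X → Y → ℝ, IsJoint q ∧ Ed q d ≤ Δ ∧
    v = mutInfo q + (1 / lam) * klX q P}

/-- Shannon entropy -/
def entropy {X : Type*} [Fintype X] (p : X → ℝ) : ℝ :=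
  -∑ x, p x * Real.log (p x)

lemma le_margX {X Y : Type*} [Fintype Y] {q : X → Y → ℝ}
    (hq : ∀ x y, 0 ≤ q x y) (x : X) (y : Y) : q x y ≤ margX q x :=
  Finset.single_le_sum (f := fun y => q x y) (fun y _ => hq x y) (Finset.mem_univ y)

lemma le_margY {X Y : Type*} [Fintype X] {q : X → Y → ℝ}
    (hq : ∀ x y, 0 ≤ q x y) (x : X) (y : Y) : q x y ≤ margY q y :=
  Finset.single_le_sum (f := fun x => q x y) (fun x _ => hq x y) (Finset.mem_univ x)

lemma margX_pos {X Y : Type*} [Fintype Y] [Nonempty Y] {p : X → Y → ℝ}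
    (hp : ∀ x y, 0 < p x y) (x : X) : 0 < margX p x :=
  Finset.sum_pos (fun y _ => hp x y) Finset.univ_nonempty

lemma margY_pos {X Y : Type*} [Fintype X] [Nonempty X] {p : X → Y → ℝ}
    (hp : ∀ x y, 0 < p x y) (y : Y) : 0 < margY p y :=
  Finset.sum_pos (fun x _ => hp x y) Finset.univ_nonempty

section Iteration

variable {X Y : Type*} [Fintype X] [Fintype Y]

/-- The sum of `f` weighted by `q`. -/
def wsum (q f : X → Y → ℝ) : ℝ := ∑ x, ∑ y, q x y * f x y

lemma wsum_add (q f g : X → Y → ℝ) :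
    wsum q (fun x y => f x y + g x y) = wsum q f + wsum q g := by
  simp only [wsum, mul_add, Finset.sum_add_distrib]

lemma wsum_sub (q f g : X → Y → ℝ) :
    wsum q (fun x y => f x y - g x y) = wsum q f - wsum q g := by
  simp only [wsum, mul_sub, Finset.sum_sub_distrib]

lemma wsum_const_mul (q f : X → Y → ℝ) (c : ℝ) :
    wsum q (fun x y => c * f x y) = c * wsum q f := by
  simp only [wsum, Finset.mul_sum, mul_left_comm c]

lemma wsum_const {q : X → Y → ℝ} (hq : IsJoint q) (c : ℝ) :
    wsum q (fun _ _ => c) = c := by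
  simp only [wsum, ← Finset.sum_mul, hq.2, one_mul]

lemma wsum_congr {q f g : X → Y → ℝ} (h : ∀ x y, q x y ≠ 0 → f x y = g x y) :
    wsum q f = wsum q g := by
  refine Finset.sum_congr rfl fun x _ => Finset.sum_congr rfl fun y _ => ?_
  by_cases h0 : q x y = 0
  · simp [h0]
  · rw [h x y h0]

lemma marg_pos_of_ne_zero {q : X → Y → ℝ} (hq : ∀ x y, 0 ≤ q x y) {x : X} {y : Y}
    (h : q x y ≠ 0) : 0 < q x y ∧ 0 < margX q x ∧ 0 < margY q y :=
  have h' := lt_of_le_of_ne (hq x y) h.symm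
  ⟨h', h'.trans_le (le_margX hq x y), h'.trans_le (le_margY hq x y)⟩

lemma sum_margX {q : X → Y → ℝ} (hq : IsJoint q) : ∑ x, margX q x = 1 := hq.2

lemma sum_margY {q : X → Y → ℝ} (hq : IsJoint q) : ∑ y, margY q y = 1 := by
  rw [← hq.2, Finset.sum_comm]; rfl

/-- Gibbs' inequality for a sub-probability `r`. -/
lemma wsum_log_le {q r : X → Y → ℝ} (hq : IsJoint q) (hr : ∀ x y, 0 ≤ r x y)
    (hr0 : ∀ x y, q x y ≠ 0 → r x y ≠ 0) (hr1 : ∑ x, ∑ y, r x y ≤ 1) :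
    wsum q (fun x y => log (r x y)) ≤ wsum q (fun x y => log (q x y)) := by
  have key : ∀ x y, q x y * log (r x y) ≤ q x y * log (q x y) + (r x y - q x y) := by
    intro x y
    by_cases h0 : q x y = 0
    · simpa [h0] using hr x y
    · have hqp := (marg_pos_of_ne_zero hq.1 h0).1
      have hrp := lt_of_le_of_ne (hr x y) (hr0 x y h0).symm
      have h1 := mul_le_mul_of_nonneg_left
        (log_le_sub_one_of_pos (div_pos hrp hqp)) hqp.le
      rw [log_div hrp.ne' hqp.ne', mul_sub, mul_sub, mul_div_cancel₀ _ h0, mul_one] at h1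
      linarith
  have h2 : wsum q (fun x y => log (r x y)) ≤
      ∑ x, ∑ y, (q x y * log (q x y) + (r x y - q x y)) :=
    Finset.sum_le_sum fun x _ => Finset.sum_le_sum fun y _ => key x y
  simp only [Finset.sum_add_distrib, Finset.sum_sub_distrib, hq.2] at h2
  unfold wsum at h2 ⊢
  linarith

lemma wsum_log_le_margX {q : X → Y → ℝ} (hq : IsJoint q) {g : X → ℝ}
    (hg : ∀ x, 0 < g x) (hg1 : ∑ x, g x = 1) :
    wsum q (fun x _ => log (g x)) ≤ wsum q (fun x _ => log (margX q x)) := by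
  have hm : ∀ x, 0 ≤ margX q x := fun x => Finset.sum_nonneg fun y _ => hq.1 x y
  have h := wsum_log_le (r := fun x y => q x y * (g x / margX q x)) hq
    (fun x y => mul_nonneg (hq.1 x y) (div_nonneg (hg x).le (hm x)))
    (fun x y h0 => by
      obtain ⟨h1, h2, -⟩ := marg_pos_of_ne_zero hq.1 h0
      exact (mul_pos h1 (div_pos (hg x) h2)).ne')
    (by
      rw [← hg1]
      refine Finset.sum_le_sum fun x _ => ?_
      rw [← Finset.sum_mul]
      change margX q x * _ ≤ _
      by_cases h0 : margX q x = 0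
      · simpa [h0] using (hg x).le
      · rw [mul_div_cancel₀ _ h0])
  rw [wsum_congr (g := fun x y => log (q x y) + (log (g x) - log (margX q x)))
    (fun x y h0 => by
      obtain ⟨h1, h2, -⟩ := marg_pos_of_ne_zero hq.1 h0
      rw [log_mul h1.ne' (div_pos (hg x) h2).ne', log_div (hg x).ne' h2.ne']),
    wsum_add, wsum_sub] at h
  linarith

lemma IsJoint.swap {q : X → Y → ℝ} (hq : IsJoint q) : IsJoint (fun y x => q x y) :=
  ⟨fun y x => hq.1 x y, by rw [Finset.sum_comm]; exact hq.2⟩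

lemma wsum_swap (q f : X → Y → ℝ) :
    wsum (fun y x => q x y) (fun y x => f x y) = wsum q f :=
  Finset.sum_comm

lemma wsum_log_le_margY {q : X → Y → ℝ} (hq : IsJoint q) {g : Y → ℝ}
    (hg : ∀ y, 0 < g y) (hg1 : ∑ y, g y = 1) :
    wsum q (fun _ y => log (g y)) ≤ wsum q (fun _ y => log (margY q y)) := by
  have h := wsum_log_le_margX hq.swap hg hg1
  rw [wsum_swap q (fun _ y => log (g y))] at h
  exact h.trans_eq (wsum_swap q (fun _ y => log (margY q y)))

lemma wsum_log_le_condX {q p : X → Y → ℝ} (hq : IsJoint q) (hp : ∀ x y, 0 < p x y) :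
    wsum q (fun x y => log (p x y)) + wsum q (fun x _ => log (margX q x))
        - wsum q (fun x _ => log (margX p x))
      ≤ wsum q (fun x y => log (q x y)) := by
  have hm : ∀ x, 0 ≤ margX q x := fun x => Finset.sum_nonneg fun y _ => hq.1 x y
  have hpm : ∀ x (_ : Y), 0 < margX p x := fun x y =>
    (hp x y).trans_le (le_margX (fun x y => (hp x y).le) x y)
  have h := wsum_log_le (r := fun x y => p x y * (margX q x / margX p x)) hq
    (fun x y => mul_nonneg (hp x y).le (div_nonneg (hm x) (hpm x y).le))
    (fun x y h0 => by
      obtain ⟨-, h2, -⟩ := marg_pos_of_ne_zero hq.1 h0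
      exact (mul_pos (hp x y) (div_pos h2 (hpm x y))).ne')
    (by
      rw [← sum_margX hq]
      refine Finset.sum_le_sum fun x _ => ?_
      rw [← Finset.sum_mul]
      change margX p x * _ ≤ _
      by_cases h0 : margX p x = 0
      · simpa [h0] using hm x
      · rw [mul_div_cancel₀ _ h0])
  rw [wsum_congr (g := fun x y => log (p x y) + (log (margX q x) - log (margX p x)))
    (fun x y h0 => by
      obtain ⟨-, h2, -⟩ := marg_pos_of_ne_zero hq.1 h0
      rw [log_mul (hp x y).ne' (div_pos h2 (hpm x y)).ne',
        log_div h2.ne' (hpm x y).ne']),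
    wsum_add, wsum_sub] at h
  linarith

lemma wsum_log_le_condY {q p : X → Y → ℝ} (hq : IsJoint q) (hp : ∀ x y, 0 < p x y) :
    wsum q (fun x y => log (p x y)) + wsum q (fun _ y => log (margY q y))
        - wsum q (fun _ y => log (margY p y))
      ≤ wsum q (fun x y => log (q x y)) := by
  have h := wsum_log_le_condX hq.swap (fun y x => hp x y)
  rw [wsum_swap q (fun x y => log (p x y)), wsum_swap q (fun x y => log (q x y))] at h
  rw [← wsum_swap q (fun _ y => log (margY q y)), ← wsum_swap q (fun _ y => log (margY p y))]
  exact h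

lemma mutInfo_eq {q : X → Y → ℝ} (hq : IsJoint q) :
    mutInfo q = wsum q (fun x y => log (q x y)) - wsum q (fun x _ => log (margX q x))
      - wsum q (fun _ y => log (margY q y)) := by
  rw [← wsum_sub, ← wsum_sub]
  refine wsum_congr fun x y h0 => ?_
  obtain ⟨h1, h2, h3⟩ := marg_pos_of_ne_zero hq.1 h0
  rw [log_div h1.ne' (mul_pos h2 h3).ne', log_mul h2.ne' h3.ne']
  ring

lemma klX_eq {q : X → Y → ℝ} (hq : IsJoint q) {P : X → ℝ} (hP : ∀ x, 0 < P x) :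
    klX q P = wsum q (fun x _ => log (margX q x)) - wsum q (fun x _ => log (P x)) := by
  rw [← wsum_sub]
  have h : klX q P = wsum q (fun x _ => log (margX q x / P x)) :=
    Finset.sum_congr rfl fun x _ => by rw [← Finset.sum_mul]; rfl
  rw [h]
  refine wsum_congr fun x y h0 => ?_
  obtain ⟨-, h2, -⟩ := marg_pos_of_ne_zero hq.1 h0
  rw [log_div h2.ne' (hP x).ne']

lemma klJoint_eq (q : X → Y → ℝ) {p : X → Y → ℝ} (hp : ∀ x y, 0 < p x y) :
    klJoint q p = wsum q (fun x y => log (q x y)) - wsum q (fun x y => log (p x y)) := by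
  rw [← wsum_sub]
  refine wsum_congr fun x y h0 => ?_
  rw [log_div h0 (hp x y).ne']

lemma mutInfo_nonneg {q : X → Y → ℝ} (hq : IsJoint q) : 0 ≤ mutInfo q := by
  rw [mutInfo_eq hq]
  have h := wsum_log_le (r := fun x y => margX q x * margY q y) hq
    (fun x y => mul_nonneg (Finset.sum_nonneg fun y _ => hq.1 x y)
      (Finset.sum_nonneg fun x _ => hq.1 x y))
    (fun x y h0 => by
      obtain ⟨-, h2, h3⟩ := marg_pos_of_ne_zero hq.1 h0
      exact (mul_pos h2 h3).ne')
    (by simp only [← Finset.mul_sum, sum_margY hq, mul_one, sum_margX hq, le_refl])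
  rw [wsum_congr (g := fun x y => log (margX q x) + log (margY q y))
    (fun x y h0 => by
      obtain ⟨-, h2, h3⟩ := marg_pos_of_ne_zero hq.1 h0
      rw [log_mul h2.ne' h3.ne']), wsum_add] at h
  linarith

lemma klX_nonneg {q : X → Y → ℝ} (hq : IsJoint q) {P : X → ℝ} (hP : ∀ x, 0 < P x)
    (hP1 : ∑ x, P x = 1) : 0 ≤ klX q P := by
  rw [klX_eq hq hP]
  linarith [wsum_log_le_margX hq hP hP1]

lemma klJoint_nonneg {q p : X → Y → ℝ} (hq : IsJoint q) (hp : IsJoint p)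
    (hpos : ∀ x y, 0 < p x y) : 0 ≤ klJoint q p := by
  rw [klJoint_eq q hpos]
  linarith [wsum_log_le hq hp.1 (fun x y _ => (hpos x y).ne') hp.2.le]

lemma wsum_omg {P : X → ℝ} (hP : ∀ x, 0 < P x) (d : X → Y → ℝ) (μ lam : ℝ)
    (q : X → Y → ℝ) {p : X → Y → ℝ} (hp : ∀ x y, 0 < p x y) :
    wsum q (omg P d μ lam p) =
      (1 - lam) * wsum q (fun x _ => log (margX p x))
        + lam * (wsum q (fun x y => log (p x y)) - wsum q (fun _ y => log (margY p y)))
        + μ * Ed q d - wsum q (fun x _ => log (P x)) := by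
  change _ = _ + μ * wsum q d - _
  rw [← wsum_sub, ← wsum_const_mul, ← wsum_const_mul, ← wsum_const_mul, ← wsum_add,
    ← wsum_add, ← wsum_sub]
  refine wsum_congr fun x y _ => ?_
  obtain ⟨h1, h2, h3⟩ := marg_pos_of_ne_zero (fun x y => (hp x y).le) (hp x y).ne'
  have h4 : 0 < condXY p x y := div_pos h1 h3
  rw [omg, log_div (by positivity) (hP x).ne', log_mul (by positivity) (exp_pos _).ne',
    log_mul (by positivity) (by positivity), log_rpow h2, log_rpow h4, log_exp, condXY,
    log_div h1.ne' h3.ne']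

/-- The quantity minimised in `OmegaF`. -/
def omegaObj (P : X → ℝ) (d : X → Y → ℝ) (μ lam : ℝ) (q : X → Y → ℝ) : ℝ :=
  lam * mutInfo q + klX q P + μ * Ed q d

lemma omegaObj_nonneg {P : X → ℝ} (hP : ∀ x, 0 < P x) (hP1 : ∑ x, P x = 1)
    {d : X → Y → ℝ} (hd : ∀ x y, 0 ≤ d x y) {μ lam : ℝ} (hμ : 0 ≤ μ) (hlam : 0 ≤ lam)
    {q : X → Y → ℝ} (hq : IsJoint q) : 0 ≤ omegaObj P d μ lam q := by
  have h1 := mul_nonneg hlam (mutInfo_nonneg hq)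
  have h2 := klX_nonneg hq hP hP1
  have h3 : 0 ≤ Ed q d := Finset.sum_nonneg fun x _ => Finset.sum_nonneg fun y _ =>
    mul_nonneg (hq.1 x y) (hd x y)
  have h4 := mul_nonneg hμ h3
  unfold omegaObj
  linarith

lemma wsum_omg_le_omegaObj [Nonempty Y] {P : X → ℝ} (hP : ∀ x, 0 < P x)
    (d : X → Y → ℝ) (μ : ℝ) {lam : ℝ} (hlam0 : 0 ≤ lam) (hlam1 : lam ≤ 1)
    {q p : X → Y → ℝ} (hq : IsJoint q) (hp : IsJoint p) (hpos : ∀ x y, 0 < p x y) :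
    wsum q (omg P d μ lam p) ≤ omegaObj P d μ lam q := by
  rw [wsum_omg hP d μ lam q hpos, omegaObj, mutInfo_eq hq, klX_eq hq hP]
  have h1 := mul_le_mul_of_nonneg_left
    (wsum_log_le_margX hq (margX_pos hpos) (sum_margX hp)) (sub_nonneg.2 hlam1)
  have h2 := mul_le_mul_of_nonneg_left (wsum_log_le_condY hq hpos) hlam0
  linarith

lemma omegaObj_le_Ffun [Nonempty X] {P : X → ℝ} (hP : ∀ x, 0 < P x)
    (d : X → Y → ℝ) (μ : ℝ) {lam : ℝ} (hlam0 : 0 ≤ lam) (hlam1 : lam ≤ 1)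
    {q p : X → Y → ℝ} (hq : IsJoint q) (hp : IsJoint p) (hpos : ∀ x y, 0 < p x y) :
    omegaObj P d μ lam q ≤ Ffun P d μ lam p q := by
  change _ ≤ wsum q (omg P d μ lam p) + _
  rw [wsum_omg hP d μ lam q hpos, omegaObj, mutInfo_eq hq, klX_eq hq hP, klJoint_eq q hpos]
  have h1 := mul_le_mul_of_nonneg_left
    (wsum_log_le_margY hq (margY_pos hpos) (sum_margY hp)) hlam0
  have h2 := mul_le_mul_of_nonneg_left (wsum_log_le_condX hq hpos) (sub_nonneg.2 hlam1)
  linarith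

/-- One step of the iteration. -/
def tilt (P : X → ℝ) (d : X → Y → ℝ) (μ lam : ℝ) (p : X → Y → ℝ) (x : X) (y : Y) : ℝ :=
  exp (-(omg P d μ lam p x y)) * p x y / Lam P d μ lam p

lemma Lam_pos [Nonempty X] [Nonempty Y] (P : X → ℝ) (d : X → Y → ℝ) (μ lam : ℝ)
    {p : X → Y → ℝ} (hpos : ∀ x y, 0 < p x y) : 0 < Lam P d μ lam p :=
  Finset.sum_pos (fun x _ => Finset.sum_pos (fun y _ => mul_pos (hpos x y) (exp_pos _))
    Finset.univ_nonempty) Finset.univ_nonempty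

lemma tilt_pos [Nonempty X] [Nonempty Y] (P : X → ℝ) (d : X → Y → ℝ) (μ lam : ℝ)
    {p : X → Y → ℝ} (hpos : ∀ x y, 0 < p x y) (x : X) (y : Y) :
    0 < tilt P d μ lam p x y :=
  div_pos (mul_pos (exp_pos _) (hpos x y)) (Lam_pos P d μ lam hpos)

lemma isJoint_tilt [Nonempty X] [Nonempty Y] (P : X → ℝ) (d : X → Y → ℝ) (μ lam : ℝ)
    {p : X → Y → ℝ} (hpos : ∀ x y, 0 < p x y) : IsJoint (tilt P d μ lam p) := by
  refine ⟨fun x y => (tilt_pos P d μ lam hpos x y).le, ?_⟩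
  simp only [tilt, ← Finset.sum_div]
  rw [div_eq_one_iff_eq (Lam_pos P d μ lam hpos).ne']
  simp only [Lam, mul_comm]

lemma Ffun_eq [Nonempty X] [Nonempty Y] (P : X → ℝ) (d : X → Y → ℝ) (μ lam : ℝ)
    {q p : X → Y → ℝ} (hq : IsJoint q) (hpos : ∀ x y, 0 < p x y) :
    Ffun P d μ lam p q = klJoint q (tilt P d μ lam p) - log (Lam P d μ lam p) := by
  have hL := Lam_pos P d μ lam hpos
  have h : wsum q (fun x y => log (tilt P d μ lam p x y)) =
      wsum q (fun x y => log (p x y)) - wsum q (omg P d μ lam p)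
        - log (Lam P d μ lam p) := by
    conv_rhs => rw [← wsum_const hq (log (Lam P d μ lam p)), ← wsum_sub, ← wsum_sub]
    refine wsum_congr fun x y _ => ?_
    rw [tilt, log_div (mul_pos (exp_pos _) (hpos x y)).ne' hL.ne',
      log_mul (exp_pos _).ne' (hpos x y).ne', log_exp]
    ring
  change wsum q (omg P d μ lam p) + _ = _
  rw [klJoint_eq q (tilt_pos P d μ lam hpos), klJoint_eq q hpos, h]
  ring

lemma klJoint_self {q : X → Y → ℝ} : klJoint q q = 0 :=
  Finset.sum_eq_zero fun x _ => Finset.sum_eq_zero fun y _ => by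
    by_cases h : q x y = 0 <;> simp [h]

lemma omegaObj_tilt_le [Nonempty X] [Nonempty Y] {P : X → ℝ} (hP : ∀ x, 0 < P x)
    (d : X → Y → ℝ) (μ : ℝ) {lam : ℝ} (hlam0 : 0 ≤ lam) (hlam1 : lam ≤ 1)
    {p : X → Y → ℝ} (hp : IsJoint p) (hpos : ∀ x y, 0 < p x y) :
    omegaObj P d μ lam (tilt P d μ lam p) ≤ -log (Lam P d μ lam p) := by
  have hq := isJoint_tilt P d μ lam hpos
  have h := omegaObj_le_Ffun hP d μ hlam0 hlam1 hq hp hpos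
  rwa [Ffun_eq P d μ lam hq hpos, klJoint_self, zero_sub] at h

lemma neg_log_Lam_le [Nonempty X] [Nonempty Y] {P : X → ℝ} (hP : ∀ x, 0 < P x)
    (d : X → Y → ℝ) (μ : ℝ) {lam : ℝ} (hlam0 : 0 ≤ lam) (hlam1 : lam ≤ 1)
    {q p : X → Y → ℝ} (hq : IsJoint q) (hp : IsJoint p) (hpos : ∀ x y, 0 < p x y) :
    -log (Lam P d μ lam p) ≤
      omegaObj P d μ lam q + (klJoint q p - klJoint q (tilt P d μ lam p)) := by
  have h := Ffun_eq P d μ lam hq hpos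
  change wsum q (omg P d μ lam p) + _ = _ at h
  linarith [wsum_omg_le_omegaObj hP d μ hlam0 hlam1 hq hp hpos]

lemma neg_log_Lam_tilt_le [Nonempty X] [Nonempty Y] {P : X → ℝ} (hP : ∀ x, 0 < P x)
    (d : X → Y → ℝ) (μ : ℝ) {lam : ℝ} (hlam0 : 0 ≤ lam) (hlam1 : lam ≤ 1)
    {p : X → Y → ℝ} (hp : IsJoint p) (hpos : ∀ x y, 0 < p x y) :
    -log (Lam P d μ lam (tilt P d μ lam p)) ≤ -log (Lam P d μ lam p) := by
  have hq := isJoint_tilt P d μ lam hpos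
  have hqpos := tilt_pos P d μ lam hpos
  have h := neg_log_Lam_le hP d μ hlam0 hlam1 hq hq hqpos
  rw [klJoint_self] at h
  linarith [omegaObj_tilt_le hP d μ hlam0 hlam1 hp hpos,
    klJoint_nonneg hq (isJoint_tilt P d μ lam hqpos) (tilt_pos P d μ lam hqpos)]

end Iteration

/-- A sequence that is nonincreasing and whose excess over `c` telescopes against a nonnegative
sequence is eventually below every `b > c`. -/
lemma eventually_lt_of_telescoping {a D : ℕ → ℝ} {b c : ℝ} (ha : Antitone a)
    (hD : ∀ n, 0 ≤ D n) (h : ∀ n, a n ≤ c + (D n - D (n + 1))) (hcb : c < b) :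
    ∀ᶠ n in atTop, a n < b := by
  have hsum : ∀ n : ℕ, n * (a n - c) ≤ D 0 - D n := by
    intro n
    induction n with
    | zero => simp
    | succ n ih =>
      have h1 := ha n.le_succ
      have h2 : ((n : ℝ) + 1) * a (n + 1) ≤ (n + 1) * a n :=
        mul_le_mul_of_nonneg_left h1 (by positivity)
      push_cast
      linarith [h n]
  obtain ⟨N, hN⟩ := exists_nat_gt (D 0 / (b - c))
  filter_upwards [eventually_ge_atTop N] with n hn
  have hn' : D 0 / (b - c) < n := hN.trans_le (by exact_mod_cast hn)
  rw [div_lt_iff₀ (sub_pos.2 hcb)] at hn'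
  by_contra! hb
  have h3 : (n : ℝ) * (b - c) ≤ n * (a n - c) :=
    mul_le_mul_of_nonneg_left (by linarith) n.cast_nonneg
  linarith [hsum n, hD n]

/-- Theorem 3: along the iteration started from an everywhere
positive joint distribution, `−log Λ_{q^{[t]}}^{(μ,λ)} → Ω^{(μ,λ)}(P)` as `t → ∞`. -/
theorem stmt15 {X Y : Type*} [Fintype X] [Fintype Y]
    (P : X → ℝ) (hP : IsDist P) (hPpos : ∀ x, 0 < P x)
    (d : X → Y → ℝ) (hd : ∀ x y, 0 ≤ d x y)
    (μ lam : ℝ) (hμ : 0 ≤ μ) (hlam0 : 0 ≤ lam) (hlam1 : lam ≤ 1)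
    (qseq : ℕ → X → Y → ℝ)
    (hinit : IsJoint (qseq 1)) (hinitpos : ∀ x y, 0 < qseq 1 x y)
    (hstep : ∀ t : ℕ, 1 ≤ t → ∀ x y,
      qseq (t + 1) x y =
        Real.exp (-(omg P d μ lam (qseq t) x y)) * qseq t x y /
          Lam P d μ lam (qseq t)) :
    Filter.Tendsto (fun t : ℕ => -Real.log (Lam P d μ lam (qseq t)))
      Filter.atTop (nhds (OmegaF P d μ lam)) := by
  have hne : Nonempty X ∧ Nonempty Y := by
    constructor <;> by_contra hemp <;> rw [not_nonempty_iff] at hemp <;>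
      simpa using hinit.2
  obtain ⟨hX, hY⟩ := hne
  have hnext : ∀ n, qseq (n + 1 + 1) = tilt P d μ lam (qseq (n + 1)) := fun n =>
    funext fun x => funext fun y => hstep (n + 1) (Nat.le_add_left 1 n) x y
  have hpos : ∀ n x y, 0 < qseq (n + 1) x y := by
    intro n
    induction n with
    | zero => exact hinitpos
    | succ n ih => rw [hnext]; exact tilt_pos P d μ lam ih
  have hjoint : ∀ n, IsJoint (qseq (n + 1)) := by
    intro n
    cases n with
    | zero => exact hinit
    | succ n => rw [hnext]; exact isJoint_tilt P d μ lam (hpos n)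
  have hbdd : BddBelow {v : ℝ | ∃ q : X → Y → ℝ, IsJoint q ∧
      v = lam * mutInfo q + klX q P + μ * Ed q d} := by
    refine ⟨0, ?_⟩
    rintro v ⟨q, hq, rfl⟩
    exact omegaObj_nonneg hPpos hP.2 hd hμ hlam0 hq
  rw [← tendsto_add_atTop_iff_nat 1]
  refine tendsto_order.2 ⟨fun b hb => Eventually.of_forall fun n => hb.trans_le ?_,
    fun b hb => ?_⟩
  · exact (csInf_le hbdd ⟨_, isJoint_tilt P d μ lam (hpos n), rfl⟩).trans
      (omegaObj_tilt_le hPpos d μ hlam0 hlam1 (hjoint n) (hpos n))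
  · obtain ⟨_, ⟨q, hq, rfl⟩, hqb⟩ := exists_lt_of_csInf_lt
      (s := {v : ℝ | ∃ q : X → Y → ℝ, IsJoint q ∧
        v = lam * mutInfo q + klX q P + μ * Ed q d}) ⟨_, qseq 1, hinit, rfl⟩ hb
    refine eventually_lt_of_telescoping (D := fun n => klJoint q (qseq (n + 1)))
      (antitone_nat_of_succ_le fun n => ?_) (fun n => klJoint_nonneg hq (hjoint n) (hpos n))
      (fun n => ?_) hqb
    · rw [hnext]
      exact neg_log_Lam_tilt_le hPpos d μ hlam0 hlam1 (hjoint n) (hpos n)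
    · rw [hnext]
      exact neg_log_Lam_le hPpos d μ hlam0 hlam1 hq (hjoint n) (hpos n)
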